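/- Let C be a prevariety of languages over a finite alphabet A. Then UPol(C) is itself a prevariety: it is a quotient-closed Boolean algebra containing only regular languages (in particular, UPol(C) is closed under complement, union, intersection, and left and right quotients by words). -/

import Mathlib

/- Common definitions: languages over a finite alphabet, classes of languages,
prevarieties, polynomial closure and its variants, separation, C-pairs, etc. -/

namespace RegLang

variable {A : Type}

/-- A language over the alphabet `A`: a set of finite words. -/
abbrev Lang (A : Type) := Set (FreeMonoid A)

/-- A class of languages over the alphabet `A`. -/
abbrev LangClass (A : Type) := Set (Lang A)

/-- A lattice of languages: contains `∅` and `A*` and is closed under binary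
union and intersection. -/
def IsLatticeClass (C : LangClass A) : Prop :=
  ∅ ∈ C ∧ (Set.univ : Lang A) ∈ C ∧
    (∀ K L : Lang A, K ∈ C → L ∈ C → K ∪ L ∈ C) ∧
    (∀ K L : Lang A, K ∈ C → L ∈ C → K ∩ L ∈ C)

/-- A Boolean algebra of languages: a lattice of languages closed under complement. -/
def IsBooleanAlgebraClass (C : LangClass A) : Prop :=
  IsLatticeClass C ∧ ∀ L ∈ C, Lᶜ ∈ C

/-- A class is quotient-closed if it is closed under left and right quotients by words. -/
def QuotientClosed (C : LangClass A) : Prop :=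
  ∀ L ∈ C, ∀ u : FreeMonoid A,
    {w : FreeMonoid A | u * w ∈ L} ∈ C ∧ {w : FreeMonoid A | w * u ∈ L} ∈ C

/-- A language is regular if it is a preimage of a subset under a monoid morphism
into a finite monoid. -/
def IsRegularLang (L : Lang A) : Prop :=
  ∃ (M : Type) (_ : Monoid M) (_ : Finite M) (φ : FreeMonoid A →* M) (F : Set M),
    L = φ ⁻¹' F

/-- A positive prevariety: a quotient-closed lattice of regular languages. -/
def IsPositivePrevariety (C : LangClass A) : Prop :=
  IsLatticeClass C ∧ QuotientClosed C ∧ ∀ L ∈ C, IsRegularLang L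

/-- A prevariety: a quotient-closed Boolean algebra of regular languages. -/
def IsPrevariety (C : LangClass A) : Prop :=
  IsBooleanAlgebraClass C ∧ QuotientClosed C ∧ ∀ L ∈ C, IsRegularLang L

/-- The marked concatenation `KaL = {uav : u ∈ K, v ∈ L}`. -/
def MarkedCat (K : Lang A) (a : A) (L : Lang A) : Lang A :=
  {w | ∃ u ∈ K, ∃ v ∈ L, w = u * FreeMonoid.of a * v}

/-- A marked concatenation `KaL` is unambiguous if every word of `KaL` has a
unique factorization `uav` with `u ∈ K` and `v ∈ L`. -/
def Unambiguous (K : Lang A) (a : A) (L : Lang A) : Prop :=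
  ∀ u u' v v' : FreeMonoid A, u ∈ K → u' ∈ K → v ∈ L → v' ∈ L →
    u * FreeMonoid.of a * v = u' * FreeMonoid.of a * v' → u = u' ∧ v = v'

/-- The marked concatenation `KaL` is left deterministic: `K ∩ KaA* = ∅`. -/
def LeftDeterministic (K : Lang A) (a : A) (_L : Lang A) : Prop :=
  K ∩ MarkedCat K a Set.univ = ∅

/-- The marked concatenation `KaL` is right deterministic: `L ∩ A*aL = ∅`. -/
def RightDeterministic (_K : Lang A) (a : A) (L : Lang A) : Prop :=
  L ∩ MarkedCat Set.univ a L = ∅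

/-- Polynomial closure: the least class containing `C` and closed under binary
union and marked concatenation. -/
inductive Pol (C : LangClass A) : Lang A → Prop
  | base {L : Lang A} : L ∈ C → Pol C L
  | union {K L : Lang A} : Pol C K → Pol C L → Pol C (K ∪ L)
  | mcat {K L : Lang A} (a : A) : Pol C K → Pol C L → Pol C (MarkedCat K a L)

/-- `coPol C`: the class of complements of languages in `Pol C`. -/
def coPol (C : LangClass A) : LangClass A := {L | ∃ K : Lang A, Pol C K ∧ L = Kᶜ}

/-- `BPol C`: the least Boolean algebra of languages containing `Pol C`. -/
inductive BPol (C : LangClass A) : Lang A → Prop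
  | base {L : Lang A} : Pol C L → BPol C L
  | empty : BPol C ∅
  | univ : BPol C Set.univ
  | union {K L : Lang A} : BPol C K → BPol C L → BPol C (K ∪ L)
  | inter {K L : Lang A} : BPol C K → BPol C L → BPol C (K ∩ L)
  | compl {L : Lang A} : BPol C L → BPol C Lᶜ

/-- Unambiguous polynomial closure: the least class containing `C` and closed
under disjoint union and unambiguous marked concatenation. -/
inductive UPol (C : LangClass A) : Lang A → Prop
  | base {L : Lang A} : L ∈ C → UPol C L
  | disjUnion {K L : Lang A} : UPol C K → UPol C L → K ∩ L = ∅ → UPol C (K ∪ L)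
  | mcat {K L : Lang A} (a : A) : UPol C K → UPol C L → Unambiguous K a L →
      UPol C (MarkedCat K a L)

/-- Alternated polynomial closure: the least class containing `C` and closed under
disjoint union and left- and right-deterministic marked concatenation. -/
inductive APol (C : LangClass A) : Lang A → Prop
  | base {L : Lang A} : L ∈ C → APol C L
  | disjUnion {K L : Lang A} : APol C K → APol C L → K ∩ L = ∅ → APol C (K ∪ L)
  | leftCat {K L : Lang A} (a : A) : APol C K → APol C L → LeftDeterministic K a L →
      APol C (MarkedCat K a L)
  | rightCat {K L : Lang A} (a : A) : APol C K → APol C L → RightDeterministic K a L →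
      APol C (MarkedCat K a L)

/-- `KaL` is left `C`-deterministic: there are `K', L' ∈ C` with `K ⊆ K'`, `L ⊆ L'`
and `K'aL'` left deterministic. -/
def LeftCDeterministic (C : LangClass A) (K : Lang A) (a : A) (L : Lang A) : Prop :=
  ∃ K' ∈ C, ∃ L' ∈ C, K ⊆ K' ∧ L ⊆ L' ∧ LeftDeterministic K' a L'

/-- `KaL` is right `C`-deterministic: there are `K', L' ∈ C` with `K ⊆ K'`, `L ⊆ L'`
and `K'aL'` right deterministic. -/
def RightCDeterministic (C : LangClass A) (K : Lang A) (a : A) (L : Lang A) : Prop :=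
  ∃ K' ∈ C, ∃ L' ∈ C, K ⊆ K' ∧ L ⊆ L' ∧ RightDeterministic K' a L'

/-- Weak alternated polynomial closure: the least class containing `C` and closed under
disjoint union and left- and right-`C`-deterministic marked concatenation. -/
inductive WAPol (C : LangClass A) : Lang A → Prop
  | base {L : Lang A} : L ∈ C → WAPol C L
  | disjUnion {K L : Lang A} : WAPol C K → WAPol C L → K ∩ L = ∅ → WAPol C (K ∪ L)
  | leftCat {K L : Lang A} (a : A) : WAPol C K → WAPol C L →
      LeftCDeterministic C K a L → WAPol C (MarkedCat K a L)
  | rightCat {K L : Lang A} (a : A) : WAPol C K → WAPol C L →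
      RightCDeterministic C K a L → WAPol C (MarkedCat K a L)

/-- `K` separates `L₁` from `L₂`. -/
def Separates (K L₁ L₂ : Lang A) : Prop := L₁ ⊆ K ∧ K ∩ L₂ = ∅

/-- `L₁` is `C`-separable from `L₂`. -/
def Separable (C : LangClass A) (L₁ L₂ : Lang A) : Prop := ∃ K ∈ C, Separates K L₁ L₂

/-- `(s, t)` is a `C`-pair for `φ`: `φ⁻¹(s)` is not `C`-separable from `φ⁻¹(t)`. -/
def CPair (C : LangClass A) {M : Type} [Monoid M] (φ : FreeMonoid A →* M)
    (s t : M) : Prop :=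
  ¬ Separable C (φ ⁻¹' {s}) (φ ⁻¹' {t})

/-- The canonical `C`-preorder on `M` associated with `φ`. -/
def CPreorder (C : LangClass A) {M : Type} [Monoid M] (φ : FreeMonoid A →* M)
    (s t : M) : Prop :=
  ∀ F : Set M, φ ⁻¹' F ∈ C → s ∈ F → t ∈ F

/-- The canonical `C`-equivalence on `M` associated with `φ`. -/
def CEquiv (C : LangClass A) {M : Type} [Monoid M] (φ : FreeMonoid A →* M)
    (s t : M) : Prop :=
  ∀ F : Set M, φ ⁻¹' F ∈ C → (s ∈ F ↔ t ∈ F)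

/-- A `C`-morphism: a surjective morphism all of whose recognized languages are in `C`. -/
def IsCMorphism (C : LangClass A) {N : Type} [Monoid N] (η : FreeMonoid A →* N) : Prop :=
  Function.Surjective η ∧ ∀ F : Set N, η ⁻¹' F ∈ C

/-- `e` is the idempotent power `s^ω` of `s`: an idempotent of the form `s^n`, `n ≥ 1`
(in a finite monoid such an element exists and is unique). -/
def IsIdempotentPower {M : Type} [Monoid M] (s e : M) : Prop :=
  IsIdempotentElem e ∧ ∃ n : ℕ, 1 ≤ n ∧ e = s ^ n

/-- The `C`-kernel of `φ`: the elements `s` such that `{ε}` is not `C`-separable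
from `φ⁻¹(s)`. -/
def gKernel (C : LangClass A) {M : Type} [Monoid M] (φ : FreeMonoid A →* M) : Set M :=
  {s | ¬ Separable C ({1} : Lang A) (φ ⁻¹' {s})}

/-- The strict `C`-kernel of `φ`: the intersection of the `C`-kernel with `φ(A⁺)`. -/
def strictGKernel (C : LangClass A) {M : Type} [Monoid M]
    (φ : FreeMonoid A →* M) : Set M :=
  gKernel C φ ∩ φ '' {w : FreeMonoid A | w ≠ 1}

/-- A group language: one recognized by a morphism into a finite group. -/
def IsGroupLanguage (L : Lang A) : Prop :=
  ∃ (G : Type) (_ : Group G) (_ : Finite G) (φ : FreeMonoid A →* G) (F : Set G),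
    L = φ ⁻¹' F

/-- A prevariety of group languages. -/
def IsGroupPrevariety (G : LangClass A) : Prop :=
  IsPrevariety G ∧ ∀ L ∈ G, IsGroupLanguage L

/-- The well-suited extension `G⁺`: all languages `L ∩ A⁺` and `L ∪ {ε}` for `L ∈ G`. -/
def wellSuited (G : LangClass A) : LangClass A :=
  {L | ∃ K ∈ G, L = K ∩ {w : FreeMonoid A | w ≠ 1} ∨ L = K ∪ ({1} : Lang A)}

/-- `le` is a partial order on the monoid `N` compatible with multiplication. -/
def IsCompatiblePartialOrder {N : Type} [Monoid N] (le : N → N → Prop) : Prop :=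
  (∀ x, le x x) ∧ (∀ x y z, le x y → le y z → le x z) ∧
    (∀ x y, le x y → le y x → x = y) ∧
    (∀ x x' y y', le x y → le x' y' → le (x * x') (y * y'))

/-- `F` is upward closed for the relation `le`. -/
def UpClosed {N : Type} (le : N → N → Prop) (F : Set N) : Prop :=
  ∀ s ∈ F, ∀ t, le s t → t ∈ F

/-- An ordered `C`-morphism: a surjective morphism onto a finite ordered monoid such
that preimages of upward closed sets are in `C`. -/
def IsOrderedCMorphism (C : LangClass A) {N : Type} [Monoid N]
    (η : FreeMonoid A →* N) (le : N → N → Prop) : Prop :=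
  Function.Surjective η ∧ IsCompatiblePartialOrder le ∧
    ∀ F : Set N, UpClosed le F → η ⁻¹' F ∈ C

/-- The syntactic preorder of `L`: `u ≼_L v` iff `xuy ∈ L → xvy ∈ L` for all `x, y`. -/
def SynPre (L : Lang A) (u v : FreeMonoid A) : Prop :=
  ∀ x y : FreeMonoid A, x * u * y ∈ L → x * v * y ∈ L

/-- `φ` is (a copy of) the syntactic morphism of `L`: it is surjective and identifies
exactly the words that are syntactically congruent for `L`. -/
def IsSyntacticMorphism (L : Lang A) {M : Type} [Monoid M]
    (φ : FreeMonoid A →* M) : Prop :=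
  Function.Surjective φ ∧
    ∀ u v : FreeMonoid A, φ u = φ v ↔ ∀ x y : FreeMonoid A, (x * u * y ∈ L ↔ x * v * y ∈ L)

/-- `le` is (a copy of) the syntactic order of `L` on the target of `φ`. -/
def IsSyntacticOrder (L : Lang A) {M : Type} [Monoid M] (φ : FreeMonoid A →* M)
    (le : M → M → Prop) : Prop :=
  ∀ u v : FreeMonoid A, le (φ u) (φ v) ↔ SynPre L u v

/-! ### Factorizations of words -/

theorem of_mul_inj {a b : A} {v v' : FreeMonoid A}
    (h : FreeMonoid.of a * v = FreeMonoid.of b * v') : a = b ∧ v = v' := by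
  have h' := congrArg FreeMonoid.toList h
  simp only [FreeMonoid.toList_mul, FreeMonoid.toList_of, List.singleton_append,
    List.cons.injEq] at h'
  exact ⟨h'.1, FreeMonoid.toList.injective h'.2⟩

/-- A marked letter in a product of two words lies in one of the two factors. -/
theorem marked_eq_mul {u v x y : FreeMonoid A} {a : A}
    (h : u * FreeMonoid.of a * v = x * y) :
    (∃ q, x = u * FreeMonoid.of a * q ∧ v = q * y) ∨
      (∃ p, u = x * p ∧ y = p * FreeMonoid.of a * v) := by
  induction x using FreeMonoid.inductionOn' generalizing u with
  | one => exact .inr ⟨u, by simp, by simpa using h.symm⟩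
  | of_mul b x ih =>
    induction u using FreeMonoid.inductionOn' with
    | one =>
      rw [one_mul, mul_assoc] at h
      obtain ⟨rfl, rfl⟩ := of_mul_inj h
      exact .inl ⟨x, by simp, rfl⟩
    | of_mul c u _ =>
      simp only [mul_assoc] at h
      obtain ⟨rfl, h'⟩ := of_mul_inj h
      rw [← mul_assoc] at h'
      rcases ih h' with ⟨q, rfl, rfl⟩ | ⟨p, rfl, rfl⟩
      · exact .inl ⟨q, by simp [mul_assoc], rfl⟩
      · exact .inr ⟨p, by simp [mul_assoc], rfl⟩

/-- Two marked factorizations of the same word coincide, or one mark precedes the other. -/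
theorem marked_eq_marked {u v u' v' : FreeMonoid A} {a b : A}
    (h : u * FreeMonoid.of a * v = u' * FreeMonoid.of b * v') :
    (u = u' ∧ a = b ∧ v = v') ∨
      (∃ q, u' = u * FreeMonoid.of a * q ∧ v = q * FreeMonoid.of b * v') ∨
      (∃ q, u = u' * FreeMonoid.of b * q ∧ v' = q * FreeMonoid.of a * v) := by
  rw [mul_assoc u'] at h
  rcases marked_eq_mul h with ⟨q, h1, h2⟩ | ⟨p, rfl, h2⟩
  · exact .inr (.inl ⟨q, h1, by rw [h2, mul_assoc]⟩)
  · induction p using FreeMonoid.inductionOn' with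
    | one =>
      rw [one_mul] at h2
      obtain ⟨rfl, rfl⟩ := of_mul_inj h2
      exact .inl ⟨by simp, rfl, rfl⟩
    | of_mul c p _ =>
      simp only [mul_assoc] at h2
      obtain ⟨rfl, rfl⟩ := of_mul_inj h2
      exact .inr (.inr ⟨p, by simp [mul_assoc], by simp [mul_assoc]⟩)

/-- The first letter of a word at which a property of prefixes breaks. -/
theorem exists_prefix_break (P : FreeMonoid A → Prop) (w : FreeMonoid A) (h1 : P 1)
    (hw : ¬ P w) :
    ∃ u a v, w = u * FreeMonoid.of a * v ∧ P u ∧ ¬ P (u * FreeMonoid.of a) := by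
  induction w using FreeMonoid.inductionOn' generalizing P with
  | one => exact absurd h1 hw
  | of_mul b w ih =>
    by_cases hb : P (FreeMonoid.of b)
    · obtain ⟨u, a, v, rfl, hu, ha⟩ := ih (fun u => P (FreeMonoid.of b * u)) (by simpa) hw
      exact ⟨FreeMonoid.of b * u, a, v, by simp [mul_assoc], hu, by simpa [mul_assoc] using ha⟩
    · exact ⟨1, b, w, by simp, h1, by simpa⟩

/-- The last letter of a word at which a property of suffixes breaks. -/
theorem exists_suffix_break (P : FreeMonoid A → Prop) (w : FreeMonoid A) (h1 : P 1)
    (hw : ¬ P w) :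
    ∃ u a v, w = u * FreeMonoid.of a * v ∧ P v ∧ ¬ P (FreeMonoid.of a * v) := by
  induction w using FreeMonoid.inductionOn' with
  | one => exact absurd h1 hw
  | of_mul b w ih =>
    by_cases hb : P w
    · exact ⟨1, b, w, by simp, hb, hw⟩
    · obtain ⟨u, a, v, rfl, hv, ha⟩ := ih hb
      exact ⟨FreeMonoid.of b * u, a, v, by simp [mul_assoc], hv, ha⟩

/-! ### Finite unions and intersections -/

theorem IsLatticeClass.iInter_mem {C : LangClass A} (hC : IsLatticeClass C) {ι : Type}
    [Finite ι] (f : ι → Lang A) (hf : ∀ i, f i ∈ C) : ⋂ i, f i ∈ C := by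
  classical
  have := Fintype.ofFinite ι
  have key : ∀ T : Finset ι, ⋂ i ∈ T, f i ∈ C := by
    intro T
    induction T using Finset.induction_on with
    | empty => simpa using hC.2.1
    | insert i T _ ih =>
      rw [Finset.set_biInter_insert]
      exact hC.2.2.2 _ _ (hf i) ih
  simpa using key Finset.univ

theorem UPol.biUnion {C : LangClass A} (hC : ∅ ∈ C) {ι : Type} [Finite ι] (T : Set ι)
    (f : ι → Lang A) (hf : ∀ i ∈ T, UPol C (f i))
    (hd : ∀ i ∈ T, ∀ j ∈ T, ∀ w, w ∈ f i → w ∈ f j → i = j) :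
    UPol C (⋃ i ∈ T, f i) := by
  induction T, T.toFinite using Set.Finite.induction_on with
  | empty => simpa using UPol.base hC
  | @insert i T hi _ ih =>
    rw [Set.biUnion_insert]
    refine .disjUnion (hf i (by simp))
      (ih (fun j hj => hf j (by simp [hj]))
        fun j hj k hk => hd j (by simp [hj]) k (by simp [hk])) ?_
    ext w
    simp only [Set.mem_inter_iff, Set.mem_iUnion, Set.mem_empty_iff_false, iff_false]
    rintro ⟨hw, j, hj, hwj⟩
    exact hi (hd i (by simp) j (by simp [hj]) w hw hwj ▸ hj)

/-! ### Syntactic congruences -/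

/-- The syntactic congruence of a language. -/
def synCon (L : Lang A) : Con (FreeMonoid A) where
  r u v := ∀ x y, x * u * y ∈ L ↔ x * v * y ∈ L
  iseqv := ⟨fun _ _ _ => Iff.rfl, fun h x y => (h x y).symm,
    fun h h' x y => (h x y).trans (h' x y)⟩
  mul' := by
    intro u u' v v' h h' x y
    have h1 := h x (v * y)
    have h2 := h' (x * u') y
    simp only [mul_assoc] at h1 h2 ⊢
    exact h1.trans h2

theorem mem_iff_of_synCon {L : Lang A} {u v : FreeMonoid A} (h : synCon L u v) :
    u ∈ L ↔ v ∈ L := by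
  simpa using h 1 1

theorem finite_quotient_of_map {c : Con (FreeMonoid A)} {X : Type} [Finite X]
    (f : FreeMonoid A → X) (hf : ∀ u v, f u = f v → c u v) : Finite c.Quotient := by
  refine Finite.of_injective (fun q : c.Quotient => f (Quotient.out q)) fun p q h => ?_
  have h' := (c.eq).2 (hf _ _ h)
  rwa [show ((Quotient.out p : FreeMonoid A) : c.Quotient) = p from Quotient.out_eq p,
    show ((Quotient.out q : FreeMonoid A) : c.Quotient) = q from Quotient.out_eq q] at h'

theorem finite_quotient_inf {c d : Con (FreeMonoid A)} [Finite c.Quotient]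
    [Finite d.Quotient] : Finite (c ⊓ d).Quotient :=
  finite_quotient_of_map (fun u => ((u : c.Quotient), (u : d.Quotient))) fun u v h => by
    rw [Prod.mk.injEq, c.eq, d.eq] at h
    exact h

theorem finite_quotient_of_le {c d : Con (FreeMonoid A)} [Finite c.Quotient] (h : c ≤ d) :
    Finite d.Quotient :=
  finite_quotient_of_map (fun u => (u : c.Quotient)) fun _ _ huv => h (c.eq.1 huv)

theorem IsRegularLang.finite_synCon {L : Lang A} (h : IsRegularLang L) :
    Finite (synCon L).Quotient := by
  obtain ⟨M, _, _, φ, F, rfl⟩ := h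
  refine finite_quotient_of_map φ fun u v huv x y => ?_
  simp [huv]

/-- The classes of the syntactic congruence of a member of a prevariety belong to it. -/
theorem IsPrevariety.synCon_class_mem {C : LangClass A} (hC : IsPrevariety C) {L : Lang A}
    (hL : L ∈ C) (u : FreeMonoid A) : {v | synCon L u v} ∈ C := by
  have := (hC.2.2 L hL).finite_synCon
  have key : {v | synCon L u v} = ⋂ i : (synCon L).Quotient × (synCon L).Quotient,
      {v | Quotient.out i.1 * u * Quotient.out i.2 ∈ L ↔
        Quotient.out i.1 * v * Quotient.out i.2 ∈ L} := by
    ext v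
    simp only [Set.mem_ofPred_eq, Set.mem_iInter]
    refine ⟨fun h i => h _ _, fun h x y => ?_⟩
    have hx : synCon L (Quotient.out (x : (synCon L).Quotient)) x :=
      (synCon L).eq.1 (Quotient.out_eq _)
    have hy : synCon L (Quotient.out (y : (synCon L).Quotient)) y :=
      (synCon L).eq.1 (Quotient.out_eq _)
    have hw : ∀ w, x * w * y ∈ L ↔ Quotient.out (x : (synCon L).Quotient) * w *
        Quotient.out (y : (synCon L).Quotient) ∈ L := fun w =>
      (mem_iff_of_synCon
        ((synCon L).mul ((synCon L).mul hx ((synCon L).refl w)) hy)).symm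
    rw [hw, hw]
    exact h (x, y)
  rw [key]
  refine hC.1.1.iInter_mem _ fun i => ?_
  have hq := (hC.2.1 _ ((hC.2.1 L hL (Quotient.out i.1)).1) (Quotient.out i.2)).2
  by_cases hu : Quotient.out i.1 * u * Quotient.out i.2 ∈ L
  · simp only [hu, true_iff]
    simpa only [Set.mem_ofPred_eq, mul_assoc] using hq
  · simp only [hu, false_iff]
    simpa only [Set.mem_ofPred_eq, mul_assoc, Set.compl_ofPred] using hC.1.2 _ hq

/-! ### Congruences that are locally trivial over a class -/

/-- A congruence `c` of finite index is locally trivial over `C` if it refines a congruence `d`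
whose classes are in `C` and such that `uvu` and `u` are `c`-equivalent as soon as `u` is
idempotent modulo `c` and `v` is `d`-equivalent to `u`. -/
def LocallyTrivialOver (C : LangClass A) (c : Con (FreeMonoid A)) : Prop :=
  Finite c.Quotient ∧ ∃ d : Con (FreeMonoid A), c ≤ d ∧ (∀ u, {v | d u v} ∈ C) ∧
    ∀ u v, c (u * u) u → d v u → c (u * v * u) u

/-- A language is a union of classes of a congruence. -/
def Saturates (c : Con (FreeMonoid A)) (L : Lang A) : Prop :=
  ∀ u v, c u v → (u ∈ L ↔ v ∈ L)

/-- The languages saturated by a congruence that is locally trivial over `C`. -/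
def locallyTrivialClass (C : LangClass A) : LangClass A :=
  {L | ∃ c, LocallyTrivialOver C c ∧ Saturates c L}

theorem LocallyTrivialOver.inf {C : LangClass A} (hC : IsLatticeClass C)
    {c c' : Con (FreeMonoid A)} (h : LocallyTrivialOver C c) (h' : LocallyTrivialOver C c') :
    LocallyTrivialOver C (c ⊓ c') := by
  obtain ⟨_, d, hcd, hd, ht⟩ := h
  obtain ⟨_, d', hcd', hd', ht'⟩ := h'
  exact ⟨finite_quotient_inf, d ⊓ d', inf_le_inf hcd hcd',
    fun u => hC.2.2.2 _ _ (hd u) (hd' u),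
    fun u v hu hv => ⟨ht u v hu.1 hv.1, ht' u v hu.2 hv.2⟩⟩

theorem exists_common_locallyTrivialOver {C : LangClass A} (hC : IsLatticeClass C)
    {K L : Lang A} (hK : K ∈ locallyTrivialClass C) (hL : L ∈ locallyTrivialClass C) :
    ∃ c, LocallyTrivialOver C c ∧ Saturates c K ∧ Saturates c L := by
  obtain ⟨c, hc, hcK⟩ := hK
  obtain ⟨c', hc', hcL⟩ := hL
  exact ⟨c ⊓ c', hc.inf hC hc', fun u v h => hcK u v h.1, fun u v h => hcL u v h.2⟩

theorem IsPrevariety.subset_locallyTrivialClass {C : LangClass A} (hC : IsPrevariety C) :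
    C ⊆ locallyTrivialClass C := by
  intro L hL
  refine ⟨synCon L, ⟨(hC.2.2 L hL).finite_synCon, synCon L, le_rfl,
    hC.synCon_class_mem hL, fun u v hu hv => ?_⟩, fun u v => mem_iff_of_synCon⟩
  exact (synCon L).trans ((synCon L).mul ((synCon L).mul ((synCon L).refl u) hv)
    ((synCon L).refl u)) ((synCon L).trans ((synCon L).mul hu ((synCon L).refl u)) hu)

theorem isPrevariety_locallyTrivialClass {C : LangClass A} (hC : IsPrevariety C) :
    IsPrevariety (locallyTrivialClass C) := by
  refine ⟨⟨⟨hC.subset_locallyTrivialClass hC.1.1.1, hC.subset_locallyTrivialClass hC.1.1.2.1,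
    fun K L hK hL => ?_, fun K L hK hL => ?_⟩, ?_⟩, ?_, ?_⟩
  · obtain ⟨c, hc, hcK, hcL⟩ := exists_common_locallyTrivialOver hC.1.1 hK hL
    exact ⟨c, hc, fun u v h => or_congr (hcK u v h) (hcL u v h)⟩
  · obtain ⟨c, hc, hcK, hcL⟩ := exists_common_locallyTrivialOver hC.1.1 hK hL
    exact ⟨c, hc, fun u v h => and_congr (hcK u v h) (hcL u v h)⟩
  · rintro L ⟨c, hc, hcL⟩
    exact ⟨c, hc, fun u v h => not_congr (hcL u v h)⟩
  · rintro L ⟨c, hc, hcL⟩ x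
    exact ⟨⟨c, hc, fun u v h => hcL _ _ (c.mul (c.refl x) h)⟩,
      ⟨c, hc, fun u v h => hcL _ _ (c.mul h (c.refl x))⟩⟩
  · rintro L ⟨c, hc, hcL⟩
    refine ⟨c.Quotient, inferInstance, hc.1, c.mk', c.mk' '' L, ?_⟩
    ext w
    refine ⟨fun h => ⟨w, h, rfl⟩, ?_⟩
    rintro ⟨v, hv, hvw⟩
    exact (hcL v w (c.eq.1 hvw)).1 hv

/-! ### Unambiguous marked concatenation preserves local triviality -/

theorem finite_synCon_markedCat {c : Con (FreeMonoid A)} [Finite c.Quotient] {K L : Lang A}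
    (hK : Saturates c K) (hL : Saturates c L) (a : A) :
    Finite (synCon (MarkedCat K a L)).Quotient := by
  let f : FreeMonoid A → c.Quotient × Set (c.Quotient × c.Quotient) := fun w =>
    (w, {p | ∃ x y, w = x * FreeMonoid.of a * y ∧ p = ((x : c.Quotient), (y : c.Quotient))})
  have key : ∀ u v, f u = f v → ∀ x y, x * u * y ∈ MarkedCat K a L →
      x * v * y ∈ MarkedCat K a L := by
    rintro u v huv x y ⟨k, hk, l, hl, h⟩
    obtain ⟨h1, h2⟩ := Prod.mk.inj huv
    have hc : c u v := c.eq.1 h1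
    rw [mul_assoc] at h
    rcases marked_eq_mul h.symm with ⟨q, rfl, rfl⟩ | ⟨p, rfl, h'⟩
    · refine ⟨k, hk, q * (v * y), (hL _ _ ?_).1 hl, by simp only [mul_assoc]⟩
      exact c.mul (c.refl q) (c.mul hc (c.refl y))
    · rcases marked_eq_mul h'.symm with ⟨q, rfl, rfl⟩ | ⟨p, rfl, rfl⟩
      · have hp : ((p : c.Quotient), (q : c.Quotient)) ∈
            {r : c.Quotient × c.Quotient | ∃ x y, v = x * FreeMonoid.of a * y ∧
              r = ((x : c.Quotient), (y : c.Quotient))} := by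
          rw [← h2]
          exact ⟨p, q, rfl, rfl⟩
        obtain ⟨p', q', rfl, hpq⟩ := hp
        rw [Prod.mk.injEq, c.eq, c.eq] at hpq
        exact ⟨x * p', (hK _ _ (c.mul (c.refl x) hpq.1)).1 hk, q' * y,
          (hL _ _ (c.mul hpq.2 (c.refl y))).1 hl, by simp only [mul_assoc]⟩
      · refine ⟨x * (v * p), (hK _ _ ?_).1 hk, l, hl, by simp only [mul_assoc]⟩
        exact c.mul (c.refl x) (c.mul hc (c.refl p))
  exact finite_quotient_of_map f fun u v h x y => ⟨key u v h x y, key v u h.symm x y⟩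

/-- If `u` absorbs `uvu` modulo a congruence saturating `K` and `L`, then `uu` and `uuvuu` are
syntactically equivalent for `KaL`, provided that the latter is unambiguous. -/
theorem synCon_markedCat_of_unambiguous {c : Con (FreeMonoid A)} {K L : Lang A}
    (hK : Saturates c K) (hL : Saturates c L) {a : A} (hU : Unambiguous K a L)
    {u v : FreeMonoid A} (h1 : c (u * v * u * u) u) (h2 : c (u * u * v * u) u)
    (h3 : c (u * (u * v * u) * u) u) :
    synCon (MarkedCat K a L) (u * u * v * u * u) (u * u) := by
  intro x y
  constructor
  · rintro ⟨k, hk, l, hl, h⟩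
    have h' : k * FreeMonoid.of a * l = (x * u) * ((u * v * u) * (u * y)) := by
      rw [← h]; simp only [mul_assoc]
    rcases marked_eq_mul h' with ⟨q, hq, rfl⟩ | ⟨p, rfl, h''⟩
    · refine ⟨k, hk, q * (u * y), (hL _ _ ?_).1 hl, ?_⟩
      · have := c.mul (c.refl q) (c.mul h1 (c.refl y))
        simpa only [mul_assoc] using this
      · rw [← mul_assoc _ q, ← hq]; simp only [mul_assoc]
    · rcases marked_eq_mul h''.symm with ⟨q, hq, rfl⟩ | ⟨p, rfl, hp⟩
      · exfalso
        have hk' : x * (u * (u * v * u) * u) * p ∈ K := (hK _ _ (c.symm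
          (c.mul (c.mul (c.refl x) h3) (c.refl p)))).1 hk
        have hl' : q * (u * (u * v * u) * u) * y ∈ L := (hL _ _ (c.symm
          (c.mul (c.mul (c.refl q) h3) (c.refl y)))).1 (by simpa only [mul_assoc] using hl)
        have he := (hU _ _ _ _ hk hk' hl' hl (by
          calc x * u * p * FreeMonoid.of a * (q * (u * (u * v * u) * u) * y)
              = x * u * (p * FreeMonoid.of a * q) * (u * (u * v * u) * u * y) := by
                simp only [mul_assoc]
            _ = x * (u * (u * v * u) * u) * (p * FreeMonoid.of a * q) * (u * y) := by
                rw [← hq]; simp only [mul_assoc]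
            _ = _ := by simp only [mul_assoc])).1
        have hlen := congrArg FreeMonoid.length he
        have hlen' := congrArg FreeMonoid.length hq
        simp only [FreeMonoid.length_mul, FreeMonoid.length_of] at hlen hlen'
        omega
      · refine ⟨x * (u * p), (hK _ _ ?_).1 hk, l, hl, ?_⟩
        · have := c.mul (c.refl x) (c.mul h2 (c.refl p))
          simpa only [mul_assoc] using this
        · have : x * (u * u) * y = x * u * (u * y) := by simp only [mul_assoc]
          rw [this, hp]; simp only [mul_assoc]
  · rintro ⟨k, hk, l, hl, h⟩
    have h' : k * FreeMonoid.of a * l = (x * u) * (u * y) := by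
      rw [← h]; simp only [mul_assoc]
    rcases marked_eq_mul h' with ⟨q, hq, rfl⟩ | ⟨p, rfl, hp⟩
    · refine ⟨k, hk, q * ((u * v * u * u) * y),
        (hL _ _ (c.symm (c.mul (c.refl q) (c.mul h1 (c.refl y))))).1 hl, ?_⟩
      rw [← mul_assoc _ q, ← hq]; simp only [mul_assoc]
    · refine ⟨x * ((u * u * v * u) * p), (hK _ _ (c.symm ?_)).1 hk, l, hl, ?_⟩
      · have := c.mul (c.refl x) (c.mul h2 (c.refl p))
        simpa only [mul_assoc] using this
      · have : x * (u * u * v * u * u) * y = x * (u * u * v * u) * (u * y) := by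
          simp only [mul_assoc]
        rw [this, hp]; simp only [mul_assoc]

theorem markedCat_mem_locallyTrivialClass {C : LangClass A} (hC : IsLatticeClass C)
    {K L : Lang A} (hK : K ∈ locallyTrivialClass C) (hL : L ∈ locallyTrivialClass C) {a : A}
    (hU : Unambiguous K a L) : MarkedCat K a L ∈ locallyTrivialClass C := by
  obtain ⟨c, ⟨_, d, hcd, hd, ht⟩, hcK, hcL⟩ := exists_common_locallyTrivialOver hC hK hL
  have := finite_synCon_markedCat hcK hcL a
  set s := synCon (MarkedCat K a L)
  refine ⟨c ⊓ s, ⟨finite_quotient_inf, d, inf_le_left.trans hcd, hd, fun u v hu hv => ?_⟩,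
    fun u v h => mem_iff_of_synCon h.2⟩
  have huv := ht u v hu.1 hv
  refine ⟨huv, ?_⟩
  have h3 : c (u * (u * v * u) * u) u := ht u _ hu.1 (hcd huv)
  have key := synCon_markedCat_of_unambiguous hcK hcL hU
    (c.trans (c.mul huv (c.refl u)) hu.1)
    (c.trans (by simpa only [mul_assoc] using c.mul (c.refl u) huv) hu.1) h3
  have h4 : s (u * v * u) (u * u * v * u * u) := s.symm (by
    simpa only [mul_assoc] using s.mul (s.mul hu.2 (s.refl v)) hu.2)
  exact s.trans h4 (s.trans key hu.2)

theorem UPol.mem_locallyTrivialClass {C : LangClass A} (hC : IsPrevariety C) {L : Lang A}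
    (h : UPol C L) : L ∈ locallyTrivialClass C := by
  induction h with
  | base h => exact hC.subset_locallyTrivialClass h
  | disjUnion _ _ _ hK hL => exact (isPrevariety_locallyTrivialClass hC).1.1.2.2.1 _ _ hK hL
  | mcat a _ _ hU hK hL => exact markedCat_mem_locallyTrivialClass hC.1.1 hK hL hU

/-! ### Two-sided ideals in finite monoids -/

section Monoid

variable {M : Type} [Monoid M]

/-- The two-sided principal ideal generated by `s`. -/
def twoSided (s : M) : Set M := {m | ∃ a b, m = a * s * b}

theorem self_mem_twoSided (s : M) : s ∈ twoSided s := ⟨1, 1, by simp⟩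

theorem mul_mul_mem_twoSided {s m : M} (h : m ∈ twoSided s) (a b : M) :
    a * m * b ∈ twoSided s := by
  obtain ⟨p, q, rfl⟩ := h
  exact ⟨a * p, q * b, by simp only [mul_assoc]⟩

theorem mul_mem_twoSided_left {s m : M} (h : m ∈ twoSided s) (a : M) :
    a * m ∈ twoSided s := by
  simpa using mul_mul_mem_twoSided h a 1

theorem mul_mem_twoSided_right {s m : M} (h : m ∈ twoSided s) (b : M) :
    m * b ∈ twoSided s := by
  simpa using mul_mul_mem_twoSided h 1 b

theorem twoSided_ssubset {s p : M} (h : s ∈ twoSided p) (hp : p ∉ twoSided s) :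
    twoSided s ⊂ twoSided p := by
  refine Set.ssubset_iff_subset_ne.2 ⟨?_, fun he => hp (he ▸ self_mem_twoSided p)⟩
  rintro m ⟨a, b, rfl⟩
  exact mul_mul_mem_twoSided h a b

theorem exists_isIdempotentElem_pow_succ [Finite M] (m : M) :
    ∃ n : ℕ, m ^ (n + 1) * m ^ (n + 1) = m ^ (n + 1) := by
  obtain ⟨i, j, hij, h⟩ : ∃ i j, i < j ∧ m ^ i = m ^ j := by
    obtain ⟨i, j, hne, h⟩ := Finite.exists_ne_map_eq_of_infinite (fun n : ℕ => m ^ n)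
    rcases lt_or_gt_of_ne hne with hlt | hlt
    · exact ⟨i, j, hlt, h⟩
    · exact ⟨j, i, hlt, h.symm⟩
  obtain ⟨k, rfl⟩ := Nat.exists_eq_add_of_lt hij
  have hper : ∀ t, m ^ (i + t * (k + 1)) = m ^ i := by
    intro t
    induction t with
    | zero => simp
    | succ t ih =>
      rw [show i + (t + 1) * (k + 1) = i + k + 1 + t * (k + 1) by ring, pow_add, ← h, ← pow_add,
        ih]
  refine ⟨(i + 1) * (k + 1) - 1, ?_⟩
  have hpos : i + 1 ≤ (i + 1) * (k + 1) := Nat.le_mul_of_pos_right _ k.succ_pos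
  obtain ⟨l, hl⟩ := Nat.exists_eq_add_of_le hpos
  rw [Nat.sub_add_cancel (by omega), ← pow_add]
  calc m ^ ((i + 1) * (k + 1) + (i + 1) * (k + 1))
      = m ^ (i + (i + 1) * (k + 1)) * m ^ (1 + l) := by rw [← pow_add]; congr 1; omega
    _ = m ^ ((i + 1) * (k + 1)) := by rw [hper, ← pow_add]; congr 1; omega

theorem eq_mul_pow_mul_pow {x α β : M} (h : x = α * x * β) (n : ℕ) :
    x = α ^ n * x * β ^ n := by
  induction n with
  | zero => simp
  | succ n ih =>
    calc x = α ^ n * (α * x * β) * β ^ n := by rw [← h]; exact ih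
      _ = _ := by rw [pow_succ, pow_succ']; simp only [mul_assoc]

/-- Stability: in a finite monoid, `x ∈ M x t M` implies `x ∈ x t M`. -/
theorem exists_eq_mul_right_of_mem_twoSided [Finite M] {x t : M} (h : x ∈ twoSided (x * t)) :
    ∃ r, x = x * t * r := by
  obtain ⟨α, β, h⟩ := h
  obtain ⟨n, hn⟩ := exists_isIdempotentElem_pow_succ (t * β)
  have hx := eq_mul_pow_mul_pow (α := α) (β := t * β) (h.trans (by simp only [mul_assoc])) (n + 1)
  refine ⟨β * (t * β) ^ n, ?_⟩
  calc x = α ^ (n + 1) * x * ((t * β) ^ (n + 1) * (t * β) ^ (n + 1)) := by rw [hn]; exact hx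
    _ = x * (t * β) ^ (n + 1) := by rw [← mul_assoc, ← hx]
    _ = _ := by rw [pow_succ']; simp only [mul_assoc]

/-- Stability: in a finite monoid, `x ∈ M t x M` implies `x ∈ M t x`. -/
theorem exists_eq_mul_left_of_mem_twoSided [Finite M] {x t : M} (h : x ∈ twoSided (t * x)) :
    ∃ l, x = l * (t * x) := by
  obtain ⟨α, β, h⟩ := h
  obtain ⟨n, hn⟩ := exists_isIdempotentElem_pow_succ (α * t)
  have hx := eq_mul_pow_mul_pow (α := α * t) (β := β) (h.trans (by simp only [mul_assoc])) (n + 1)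
  refine ⟨(α * t) ^ n * α, ?_⟩
  calc x = ((α * t) ^ (n + 1) * (α * t) ^ (n + 1)) * x * β ^ (n + 1) := by rw [hn]; exact hx
    _ = (α * t) ^ (n + 1) * x := by
      rw [mul_assoc _ _ x, mul_assoc _ (_ * x), ← hx]
    _ = _ := by rw [pow_succ]; simp only [mul_assoc]

end Monoid

/-! ### Classes of locally trivial congruences are in the unambiguous polynomial closure -/

/-- Inside a two-sided ideal, the product `xzy` depends on `z` only modulo `d`. -/
theorem mul_mul_eq_of_mem_twoSided {c d : Con (FreeMonoid A)} [Finite c.Quotient]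
    (ht : ∀ u v, c (u * u) u → d v u → c (u * v * u) u) {s x y : c.Quotient}
    (hx : x ∈ twoSided s) (hy : y ∈ twoSided s) {z z₀ : FreeMonoid A} (hz : d z z₀)
    (h : x * z₀ * y = s) : x * z * y = s := by
  obtain ⟨r, hr⟩ : ∃ r, x = s * r := by
    rw [← h, mul_assoc] at hx ⊢
    exact exists_eq_mul_right_of_mem_twoSided hx
  obtain ⟨l, hl⟩ : ∃ l, y = l * s := by
    rw [← h] at hy ⊢
    exact exists_eq_mul_left_of_mem_twoSided hy
  have hyr : y * r * z₀ * y = y := by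
    calc y * r * z₀ * y = l * (s * r * z₀ * y) := by
          rw [hl]; simp only [mul_assoc]
      _ = y := by rw [← hr, h, ← hl]
  obtain ⟨w, hw⟩ := c.mk'_surjective (y * r)
  have hw' : (w : c.Quotient) = y * r := hw
  have hidem : c (z₀ * w * (z₀ * w)) (z₀ * w) := by
    rw [← c.eq]
    simp only [Con.coe_mul, hw']
    calc (z₀ : c.Quotient) * (y * r) * (z₀ * (y * r)) = z₀ * (y * r * z₀ * y) * r := by
          simp only [mul_assoc]
      _ = _ := by rw [hyr, mul_assoc]
  have key := c.eq.2 (ht _ (z * w) hidem (d.mul hz (d.refl w)))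
  simp only [Con.coe_mul, hw'] at key
  have hx0 : x * (z₀ * (y * r)) = x := by
    rw [← mul_assoc, ← mul_assoc, h, ← hr]
  have hxz : x * z * y * r = x := by
    calc x * z * y * r = x * (z₀ * (y * r)) * z * (y * r * z₀ * y) * r := by
          rw [hx0, hyr]
      _ = x * (z₀ * (y * r) * (z * (y * r)) * (z₀ * (y * r))) := by simp only [mul_assoc]
      _ = x := by rw [key, hx0]
  calc x * z * y = x * z * (y * r * z₀ * y) := by rw [hyr]
    _ = x * z * y * r * z₀ * y := by simp only [mul_assoc]
    _ = s := by rw [hxz, h]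

/-- The class of a unit modulo `c` is a class of `d`. -/
theorem upol_class_of_one_mem_twoSided {C : LangClass A} {c d : Con (FreeMonoid A)}
    [Finite c.Quotient] (hcd : c ≤ d) (hd : ∀ u, {v | d u v} ∈ C)
    (ht : ∀ u v, c (u * u) u → d v u → c (u * v * u) u) {s : c.Quotient}
    (hs : 1 ∈ twoSided s) : UPol C {w | (w : c.Quotient) = s} := by
  obtain ⟨a, b, h⟩ := hs
  have h1 : s * (b * a) = 1 := by
    rw [← mul_assoc]
    exact mul_eq_one_comm.1 (by rw [← mul_assoc, ← h])
  have h2 : b * a * s = 1 := mul_eq_one_comm.1 h1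
  obtain ⟨w₀, rfl⟩ := c.mk'_surjective s
  obtain ⟨r, hr⟩ := c.mk'_surjective (b * a)
  rw [← hr] at h1 h2
  have : {w : FreeMonoid A | (w : c.Quotient) = c.mk' w₀} = {w | d w₀ w} := by
    ext w
    refine ⟨fun h => d.symm (hcd (c.eq.1 h)), fun h => ?_⟩
    have h3 : d (w * r) 1 :=
      d.trans (d.mul (d.symm h) (d.refl r)) (hcd (c.eq.1 h1))
    have h4 : (w : c.Quotient) * c.mk' r = 1 :=
      c.eq.2 (by simpa using ht 1 (w * r) (by simpa using c.refl 1) h3)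
    calc (w : c.Quotient) = w * (c.mk' r * c.mk' w₀) := by rw [h2, mul_one]
      _ = _ := by rw [← mul_assoc, h4, one_mul]
  rw [this]
  exact .base (hd w₀)

/-- If `x` generates the same two-sided ideal as `s`, the words leading from `x` to `s` form a
language in `UPol C`, provided that the classes strictly above `s` do. -/
theorem upol_right_factors [Finite A] {C : LangClass A} (hC : ∅ ∈ C) {c d : Con (FreeMonoid A)}
    [Finite c.Quotient] (hcd : c ≤ d) (hd : ∀ u, {v | d u v} ∈ C)
    (ht : ∀ u v, c (u * u) u → d v u → c (u * v * u) u) {s : c.Quotient}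
    (ih : ∀ p : c.Quotient, s ∈ twoSided p → p ∉ twoSided s →
      UPol C {w | (w : c.Quotient) = p})
    (hs : 1 ∉ twoSided s) {x : c.Quotient} (hx : x ∈ twoSided s) :
    UPol C {v | x * (v : c.Quotient) = s} := by
  have := finite_quotient_of_le hcd
  have hinner : UPol C (⋃ i ∈ {i : d.Quotient × A × c.Quotient |
      s ∈ twoSided i.2.2 ∧ i.2.2 ∉ twoSided s ∧
      (FreeMonoid.of i.2.1 : FreeMonoid A) * i.2.2 ∈ twoSided s ∧
      ∃ z₀ : FreeMonoid A, (z₀ : d.Quotient) = i.1 ∧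
        x * z₀ * ((FreeMonoid.of i.2.1 : FreeMonoid A) * i.2.2) = s},
      MarkedCat {z | (z : d.Quotient) = i.1} i.2.1 {w | (w : c.Quotient) = i.2.2}) := by
    refine UPol.biUnion hC _ _ ?_ ?_
    · rintro ⟨n, b, q⟩ ⟨h1, h2, h3, z₀, rfl, -⟩
      refine .mcat b (.base ?_) (ih q h1 h2) ?_
      · convert hd z₀ using 3 with z
        exact eq_comm.trans d.eq
      · rintro u u' v v' - - hv hv' h
        simp only [Set.mem_ofPred_eq] at hv hv' h2 h3
        rcases marked_eq_marked h with ⟨h, -, h'⟩ | ⟨t, -, rfl⟩ | ⟨t, -, rfl⟩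
        · exact ⟨h, h'⟩
        · refine absurd (mul_mem_twoSided_left h3 (t : c.Quotient)) ?_
          rwa [← hv', ← mul_assoc, ← Con.coe_mul, ← Con.coe_mul, hv]
        · refine absurd (mul_mem_twoSided_left h3 (t : c.Quotient)) ?_
          rwa [← hv, ← mul_assoc, ← Con.coe_mul, ← Con.coe_mul, hv']
    · rintro ⟨n, b, q⟩ ⟨-, h2, h3, -⟩ ⟨n', b', q'⟩ ⟨-, h2', h3', -⟩ w
        ⟨u, hu, v, hv, rfl⟩ ⟨u', hu', v', hv', h⟩
      simp only [Set.mem_ofPred_eq] at *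
      subst hu hv hu' hv'
      rcases marked_eq_marked h with ⟨rfl, rfl, rfl⟩ | ⟨t, -, rfl⟩ | ⟨t, -, rfl⟩
      · rfl
      · exact absurd (by simpa [mul_assoc] using
          mul_mem_twoSided_left h3' (t : c.Quotient)) h2
      · exact absurd (by simpa [mul_assoc] using
          mul_mem_twoSided_left h3 (t : c.Quotient)) h2'
  have houter : UPol C (⋃ q ∈ {q : c.Quotient | x * q = s ∧ q ∉ twoSided s},
      {w : FreeMonoid A | (w : c.Quotient) = q}) := by
    refine UPol.biUnion hC _ _ ?_ ?_
    · rintro q ⟨h1, h2⟩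
      exact ih q ⟨x, 1, by simp [h1]⟩ h2
    · rintro q - q' - w rfl h
      exact h
  have heq := UPol.disjUnion houter hinner (by
    ext w
    simp only [Set.mem_inter_iff, Set.mem_iUnion, Set.mem_empty_iff_false, iff_false]
    rintro ⟨⟨q, ⟨-, hq⟩, rfl⟩, ⟨n, b, q'⟩, ⟨-, -, h3, -⟩, u, -, v, rfl, rfl⟩
    exact hq (by simpa [mul_assoc] using mul_mem_twoSided_left h3 (u : c.Quotient)))
  convert heq using 1
  ext w
  simp only [Set.mem_union, Set.mem_iUnion, Set.mem_ofPred_eq]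
  constructor
  · intro hw
    by_cases hwI : (w : c.Quotient) ∈ twoSided s
    · obtain ⟨u, b, v, rfl, hv, hbv⟩ := exists_suffix_break
        (fun v => (v : c.Quotient) ∉ twoSided s) w hs (not_not.2 hwI)
      simp only [not_not, Con.coe_mul] at hbv hw
      refine .inr ⟨(u, b, v), ⟨⟨x * u * (FreeMonoid.of b : FreeMonoid A), 1, ?_⟩, hv, hbv,
        u, rfl, ?_⟩, u, rfl, v, rfl, rfl⟩
      · rw [← hw]; simp only [mul_assoc, mul_one]
      · rw [← hw]; simp only [mul_assoc]
    · exact .inl ⟨_, ⟨hw, hwI⟩, rfl⟩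
  · rintro (⟨q, ⟨hq, -⟩, rfl⟩ | ⟨⟨n, b, q⟩, ⟨-, -, h3, z₀, rfl, h⟩, u, hu, v, rfl, rfl⟩)
    · exact hq
    · rw [← mul_mul_eq_of_mem_twoSided ht hx h3 (d.eq.1 hu) h]
      simp only [Con.coe_mul, mul_assoc]

theorem upol_class [Finite A] {C : LangClass A} (hC : ∅ ∈ C) {c d : Con (FreeMonoid A)}
    [Finite c.Quotient] (hcd : c ≤ d) (hd : ∀ u, {v | d u v} ∈ C)
    (ht : ∀ u v, c (u * u) u → d v u → c (u * v * u) u) (s : c.Quotient) :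
    UPol C {w | (w : c.Quotient) = s} := by
  induction hI : twoSided s using (wellFounded_gt (α := Set c.Quotient)).induction
    generalizing s with
  | _ I ih =>
  subst hI
  replace ih : ∀ p : c.Quotient, s ∈ twoSided p → p ∉ twoSided s →
      UPol C {w | (w : c.Quotient) = p} :=
    fun p hp hps => ih _ (twoSided_ssubset hp hps) p rfl
  by_cases hs : 1 ∈ twoSided s
  · exact upol_class_of_one_mem_twoSided hcd hd ht hs
  have key : UPol C (⋃ i ∈ {i : c.Quotient × A | s ∈ twoSided i.1 ∧ i.1 ∉ twoSided s ∧
      i.1 * (FreeMonoid.of i.2 : FreeMonoid A) ∈ twoSided s},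
      MarkedCat {w | (w : c.Quotient) = i.1} i.2
        {v | i.1 * (FreeMonoid.of i.2 : FreeMonoid A) * (v : c.Quotient) = s}) := by
    refine UPol.biUnion hC _ _ ?_ ?_
    · rintro ⟨p, a⟩ ⟨h1, h2, h3⟩
      refine .mcat a (ih p h1 h2) (upol_right_factors hC hcd hd ht ih hs h3) ?_
      rintro u u' v v' rfl hu' - - h
      simp only [Set.mem_ofPred_eq] at hu' h2 h3
      rcases marked_eq_marked h with ⟨h, -, h'⟩ | ⟨t, rfl, -⟩ | ⟨t, rfl, -⟩
      · exact ⟨h, h'⟩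
      · refine absurd (mul_mem_twoSided_right h3 (t : c.Quotient)) ?_
        rwa [← Con.coe_mul, ← Con.coe_mul, hu']
      · refine absurd (mul_mem_twoSided_right h3 (t : c.Quotient)) ?_
        rwa [← hu', ← Con.coe_mul, ← Con.coe_mul]
    · rintro ⟨p, a⟩ ⟨-, h2, h3⟩ ⟨p', a'⟩ ⟨-, h2', h3'⟩ w
        ⟨u, hu, v, -, rfl⟩ ⟨u', hu', v', -, h⟩
      simp only [Set.mem_ofPred_eq] at *
      subst hu hu'
      rcases marked_eq_marked h with ⟨rfl, rfl, rfl⟩ | ⟨t, rfl, -⟩ | ⟨t, rfl, -⟩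
      · rfl
      · exact absurd (mul_mem_twoSided_right h3 (t : c.Quotient)) h2'
      · exact absurd (mul_mem_twoSided_right h3' (t : c.Quotient)) h2
  convert key using 1
  ext w
  simp only [Set.mem_iUnion, Set.mem_ofPred_eq]
  constructor
  · rintro rfl
    obtain ⟨u, a, v, rfl, hu, hua⟩ := exists_prefix_break
      (fun v => (v : c.Quotient) ∉ twoSided (w : c.Quotient)) w hs
      (not_not.2 (self_mem_twoSided _))
    refine ⟨(u, a), ⟨⟨1, (FreeMonoid.of a * v : FreeMonoid A), ?_⟩, hu, ?_⟩,
      u, rfl, v, rfl, rfl⟩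
    · simp only [Con.coe_mul, mul_assoc, one_mul]
    · simpa only [not_not, Con.coe_mul] using hua
  · rintro ⟨⟨p, a⟩, -, u, rfl, v, hv, rfl⟩
    exact hv

theorem upol_iff_mem_locallyTrivialClass [Finite A] {C : LangClass A} (hC : IsPrevariety C)
    {L : Lang A} : UPol C L ↔ L ∈ locallyTrivialClass C := by
  refine ⟨UPol.mem_locallyTrivialClass hC, ?_⟩
  rintro ⟨c, ⟨_, d, hcd, hd, ht⟩, hcL⟩
  have key := UPol.biUnion hC.1.1.1 (c.mk' '' L)
    (fun s => {w | (w : c.Quotient) = s}) (fun s _ => upol_class hC.1.1.1 hcd hd ht s)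
    (fun s _ s' _ w h h' => h.symm.trans h')
  convert key using 1
  ext w
  simp only [Set.mem_iUnion, Set.mem_ofPred_eq]
  refine ⟨fun h => ⟨_, ⟨w, h, rfl⟩, rfl⟩, ?_⟩
  rintro ⟨_, ⟨v, hv, rfl⟩, h⟩
  exact (hcL w v (c.eq.1 h)).2 hv

/-- For a prevariety `C`, the class `UPol C` is itself a prevariety:
a quotient-closed Boolean algebra of regular languages. -/
theorem upol_isPrevariety {A : Type} [Fintype A] (C : LangClass A)
    (hC : IsPrevariety C) :
    IsPrevariety {L : Lang A | UPol C L} := by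
  have : {L : Lang A | UPol C L} = locallyTrivialClass C :=
    Set.ext fun L => upol_iff_mem_locallyTrivialClass hC
  rw [this]
  exact isPrevariety_locallyTrivialClass hC

end RegLang
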